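/- Let k ≥ 1 be an integer, R > 0, and let x ∈ ℝ^{k+1} be a fixed point with |x| ≠ R. For every real number b and α = k/2 + ib, the integral ∫_{S^k(R)} ω(x,y)^α dS_y is real; more precisely, ∫_{S^k(R)} ω(x,y)^{k/2 + ib} dS_y = ∫_{S^k(R)} ω(x,y)^{k/2} cos(b · ln ω(x,y)) dS_y. -/

import Mathlib

open MeasureTheory

/-- The spherical ratio `ω(x,y) = |‖x‖² − R²| / ‖x − y‖²`. -/
noncomputable def sRatio {n : ℕ} (R : ℝ) (x y : EuclideanSpace ℝ (Fin n)) : ℝ :=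
  |‖x‖ ^ 2 - R ^ 2| / ‖x - y‖ ^ 2

open Set Filter Topology Metric
open scoped ENNReal NNReal

theorem hausdorffMeasure_image_le_lintegral_rpow {X Y : Type*}
    [EMetricSpace X] [MeasurableSpace X] [BorelSpace X]
    [EMetricSpace Y] [MeasurableSpace Y] [BorelSpace Y]
    {T : X → Y} {W : X → ℝ≥0} {s : Set X} {d : ℝ} (hd : 0 ≤ d) (hs : MeasurableSet s)
    (hW : Measurable W) (hpos : ∀ y ∈ s, W y ≠ 0)
    (hlip : ∀ a : ℝ≥0, LipschitzOnWith a T (s ∩ {y | W y ≤ a})) :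
    μH[d] (T '' s) ≤ ∫⁻ y in s, (W y : ℝ≥0∞) ^ d ∂μH[d] := by
  have key : ∀ t : ℝ≥0, 1 < t →
      μH[d] (T '' s) ≤ (t : ℝ≥0∞) ^ d * ∫⁻ y in s, (W y : ℝ≥0∞) ^ d ∂μH[d] := by
    intro t ht
    have ht0 : t ≠ 0 := (zero_lt_one.trans ht).ne'
    set A : ℤ → Set X := fun n => s ∩ W ⁻¹' Ico (t ^ n) (t ^ (n + 1)) with hA
    have hAm : ∀ n, MeasurableSet (A n) := fun n => hs.inter (hW measurableSet_Ico)
    have hdisj : Pairwise (Function.onFun Disjoint A) := by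
      intro m n hmn
      have := (zpow_right_mono₀ ht.le).pairwise_disjoint_on_Ico_succ hmn
      exact (this.preimage W).mono inter_subset_right inter_subset_right
    have hcov : s ⊆ ⋃ n, A n := by
      intro y hy
      obtain ⟨n, hn⟩ := NNReal.exists_mem_Ico_zpow (hpos y hy) ht
      exact mem_iUnion.2 ⟨n, hy, hn⟩
    have hn : ∀ n, μH[d] (T '' A n) ≤ (t : ℝ≥0∞) ^ d * ∫⁻ y in A n, (W y : ℝ≥0∞) ^ d ∂μH[d] := by
      intro n
      have h1 : LipschitzOnWith (t ^ (n + 1)) T (A n) :=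
        (hlip _).mono fun y hy => ⟨hy.1, hy.2.2.le⟩
      refine (h1.hausdorffMeasure_image_le hd).trans ?_
      have h2 : ((t ^ n : ℝ≥0) : ℝ≥0∞) ^ d * μH[d] (A n) ≤
          ∫⁻ y in A n, (W y : ℝ≥0∞) ^ d ∂μH[d] := by
        rw [← setLIntegral_const]
        refine setLIntegral_mono' (hAm n) fun y hy => ?_
        exact ENNReal.rpow_le_rpow (ENNReal.coe_le_coe.2 hy.2.1) hd
      calc ((t ^ (n + 1) : ℝ≥0) : ℝ≥0∞) ^ d * μH[d] (A n)
          = (t : ℝ≥0∞) ^ d * (((t ^ n : ℝ≥0) : ℝ≥0∞) ^ d * μH[d] (A n)) := by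
            rw [zpow_add_one₀ ht0, mul_comm (t ^ n), ENNReal.coe_mul,
              ENNReal.mul_rpow_of_nonneg _ _ hd, mul_assoc]
        _ ≤ _ := by gcongr
    calc μH[d] (T '' s) ≤ μH[d] (⋃ n, T '' A n) := by
          rw [← image_iUnion]; exact measure_mono (image_mono hcov)
      _ ≤ ∑' n, μH[d] (T '' A n) := measure_iUnion_le _
      _ ≤ ∑' n, (t : ℝ≥0∞) ^ d * ∫⁻ y in A n, (W y : ℝ≥0∞) ^ d ∂μH[d] := ENNReal.tsum_le_tsum hn
      _ = (t : ℝ≥0∞) ^ d * ∫⁻ y in ⋃ n, A n, (W y : ℝ≥0∞) ^ d ∂μH[d] := by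
          rw [ENNReal.tsum_mul_left, lintegral_iUnion hAm hdisj]
      _ ≤ _ := by
          gcongr
          exact iUnion_subset fun n => inter_subset_left
  have hlim : Tendsto (fun t : ℝ≥0 => (t : ℝ≥0∞) ^ d * ∫⁻ y in s, (W y : ℝ≥0∞) ^ d ∂μH[d])
      (𝓝[>] 1) (𝓝 (((1 : ℝ≥0) : ℝ≥0∞) ^ d * ∫⁻ y in s, (W y : ℝ≥0∞) ^ d ∂μH[d])) := by
    refine ENNReal.Tendsto.mul_const ?_ (Or.inl (by simp))
    exact ((ENNReal.continuous_rpow_const.tendsto _).comp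
      (ENNReal.continuous_coe.tendsto 1)).mono_left nhdsWithin_le_nhds
  simpa using ge_of_tendsto hlim (eventually_mem_of_tendsto_nhdsWithin tendsto_id |>.mono key)

theorem lipschitzOnWith_inv_norm_smul {E : Type*} [NormedAddCommGroup E] [NormedSpace ℝ E] :
    LipschitzOnWith 2 (fun v : E => ‖v‖⁻¹ • v) {v | 1 ≤ ‖v‖} := by
  refine LipschitzOnWith.of_dist_le_mul fun u hu v hv => ?_
  have hu' : (1 : ℝ) ≤ ‖u‖ := hu
  have hv' : (1 : ℝ) ≤ ‖v‖ := hv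
  have hu0 : ‖u‖ ≠ 0 := by positivity
  have hv0 : ‖v‖ ≠ 0 := by positivity
  have e : ‖u‖⁻¹ • u - ‖v‖⁻¹ • v = ‖u‖⁻¹ • ((u - v) + ((‖v‖ - ‖u‖) * ‖v‖⁻¹) • v) := by
    have : ‖u‖⁻¹ * ((‖v‖ - ‖u‖) * ‖v‖⁻¹) = ‖u‖⁻¹ - ‖v‖⁻¹ := by field_simp
    rw [smul_add, smul_smul, this, smul_sub, sub_smul]
    abel
  have h1 : ‖((‖v‖ - ‖u‖) * ‖v‖⁻¹) • v‖ ≤ ‖u - v‖ := by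
    rw [norm_smul, norm_mul, norm_inv, norm_norm, mul_assoc, inv_mul_cancel₀ hv0, mul_one,
      norm_sub_rev u v]
    exact abs_norm_sub_norm_le v u
  rw [dist_eq_norm, dist_eq_norm, e, norm_smul, norm_inv, norm_norm]
  have h2 := norm_add_le (u - v) (((‖v‖ - ‖u‖) * ‖v‖⁻¹) • v)
  calc ‖u‖⁻¹ * ‖(u - v) + ((‖v‖ - ‖u‖) * ‖v‖⁻¹) • v‖
      ≤ 1 * (‖u - v‖ + ‖u - v‖) := by
        gcongr
        · exact inv_le_one_of_one_le₀ hu'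
        · linarith
    _ = _ := by simp; ring

theorem hausdorffMeasure_sphere_lt_top (k : ℕ) {R : ℝ} (hR : 0 < R) :
    μH[(k : ℝ)] (sphere (0 : EuclideanSpace ℝ (Fin (k + 1))) R) < ∞ := by
  let c : Fin (k + 1) → ℝ → (Fin k → ℝ) → EuclideanSpace ℝ (Fin (k + 1)) :=
    fun i e z => WithLp.toLp 2 (i.insertNth e z)
  let N : EuclideanSpace ℝ (Fin (k + 1)) → EuclideanSpace ℝ (Fin (k + 1)) :=
    fun v => ‖v‖⁻¹ • v
  have hc : ∀ i e, ∃ K, LipschitzWith K (c i e) := by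
    intro i e
    refine ⟨_, (PiLp.lipschitzWith_toLp 2 (fun _ : Fin (k + 1) => ℝ)).comp
      (LipschitzWith.of_dist_le_mul (K := 1) (f := fun z : Fin k → ℝ =>
        (i.insertNth e z : Fin (k + 1) → ℝ)) fun z w => ?_)⟩
    rw [Fin.dist_insertNth_insertNth]
    simp
  have hnorm : ∀ i e z, |e| = 1 → 1 ≤ ‖c i e z‖ := by
    intro i e z he
    have := PiLp.norm_apply_le (c i e z) i
    simpa [c, he] using this
  have hfin : ∀ i e, |e| = 1 →
      μH[(k : ℝ)] ((fun z => R • N (c i e z)) '' closedBall (0 : Fin k → ℝ) 1) < ∞ := by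
    intro i e he
    obtain ⟨K, hK⟩ := hc i e
    have h1 : LipschitzOnWith (‖R‖₊ * (2 * K)) (fun z => R • N (c i e z))
        (closedBall (0 : Fin k → ℝ) 1) :=
      (lipschitzWith_smul R).comp_lipschitzOnWith
        (lipschitzOnWith_inv_norm_smul.comp hK.lipschitzOnWith fun z _ => hnorm i e z he)
    refine (h1.hausdorffMeasure_image_le (Nat.cast_nonneg k)).trans_lt ?_
    refine ENNReal.mul_lt_top (ENNReal.rpow_lt_top_of_nonneg (Nat.cast_nonneg k) ENNReal.coe_ne_top) ?_
    have h2 : (μH[(k : ℝ)] : Measure (Fin k → ℝ)) = volume := by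
      simpa using hausdorffMeasure_pi_real (ι := Fin k)
    rw [h2]
    exact measure_closedBall_lt_top
  have hcov : sphere (0 : EuclideanSpace ℝ (Fin (k + 1))) R ⊆
      ⋃ i : Fin (k + 1), ((fun z => R • N (c i 1 z)) '' closedBall (0 : Fin k → ℝ) 1) ∪
        ((fun z => R • N (c i (-1) z)) '' closedBall (0 : Fin k → ℝ) 1) := by
    intro y hy
    have hyR : ‖y‖ = R := by simpa using hy
    obtain ⟨i, hi⟩ := Finite.exists_max fun j => |y j|
    have hy0 : y ≠ 0 := by rintro rfl; simp at hyR; exact hR.ne hyR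
    have hm : 0 < |y i| := by
      by_contra h
      apply hy0
      ext j
      have := hi j
      exact abs_nonpos_iff.1 (this.trans (not_lt.1 h))
    have main : ∀ e, y i = |y i| * e →
        y ∈ (fun z => R • N (c i e z)) '' closedBall (0 : Fin k → ℝ) 1 := by
      intro e he
      refine ⟨fun j => |y i|⁻¹ * y (i.succAbove j), ?_, ?_⟩
      · rw [mem_closedBall_zero_iff, pi_norm_le_iff_of_nonneg zero_le_one]
        intro j
        rw [norm_mul, norm_inv, Real.norm_eq_abs, Real.norm_eq_abs, abs_abs]
        rw [inv_mul_le_iff₀ hm, mul_one]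
        exact hi _
      · have : c i e (fun j => |y i|⁻¹ * y (i.succAbove j)) = |y i|⁻¹ • y := by
          ext j
          refine Fin.succAboveCases i ?_ (fun j => ?_) j
          · simp only [c, Fin.insertNth_apply_same, PiLp.smul_apply, smul_eq_mul]
            rw [eq_inv_mul_iff_mul_eq₀ hm.ne']
            exact he.symm
          · simp [c]
        simp only [N, this, norm_smul, smul_smul, hyR]
        rw [norm_inv, Real.norm_eq_abs, abs_abs]
        have : R * ((|y i|⁻¹ * R)⁻¹ * |y i|⁻¹) = 1 := by field_simp
        rw [this, one_smul]
    refine mem_iUnion.2 ⟨i, ?_⟩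
    rcases le_total 0 (y i) with h | h
    · left; apply main; rw [abs_of_nonneg h, mul_one]
    · right; apply main; rw [abs_of_nonpos h]; ring
  refine (measure_mono hcov).trans_lt ((measure_iUnion_le _).trans_lt ?_)
  rw [tsum_fintype]
  refine ENNReal.sum_lt_top.2 fun i _ => ?_
  exact (measure_union_le _ _).trans_lt
    (ENNReal.add_lt_top.2 ⟨hfin i 1 (by simp), hfin i (-1) (by simp)⟩)

/-- The map sending `y` to the second intersection of the line through `x` and `y` with the sphere
of radius `R` centred at the origin, extended to the whole space by the same formula. -/
noncomputable def secantMap {n : ℕ} (R : ℝ) (x y : EuclideanSpace ℝ (Fin n)) :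
    EuclideanSpace ℝ (Fin n) :=
  x + ((‖x‖ ^ 2 - R ^ 2) / ‖y - x‖ ^ 2) • (y - x)

section secantMap

variable {n : ℕ} {R : ℝ} {x y z : EuclideanSpace ℝ (Fin n)}

theorem norm_secantMap_sub (hy : y ≠ x) :
    ‖secantMap R x y - x‖ = |‖x‖ ^ 2 - R ^ 2| / ‖y - x‖ := by
  have h : ‖y - x‖ ≠ 0 := norm_ne_zero_iff.2 (sub_ne_zero.2 hy)
  rw [secantMap, add_sub_cancel_left, norm_smul, norm_div, norm_pow, norm_norm, Real.norm_eq_abs]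
  field_simp

theorem secantMap_secantMap (hs : ‖x‖ ^ 2 - R ^ 2 ≠ 0) :
    secantMap R x (secantMap R x y) = y := by
  rcases eq_or_ne y x with rfl | hy
  · simp [secantMap]
  have h : ‖y - x‖ ≠ 0 := norm_ne_zero_iff.2 (sub_ne_zero.2 hy)
  have e : secantMap R x y - x = ((‖x‖ ^ 2 - R ^ 2) / ‖y - x‖ ^ 2) • (y - x) := by
    simp [secantMap]
  have h1 : (‖x‖ ^ 2 - R ^ 2) / ‖secantMap R x y - x‖ ^ 2 *
      ((‖x‖ ^ 2 - R ^ 2) / ‖y - x‖ ^ 2) = 1 := by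
    rw [norm_secantMap_sub hy, div_pow, sq_abs]
    field_simp
  conv_lhs => rw [secantMap, e, smul_smul, ← e, h1, one_smul]
  abel

theorem norm_secantMap (hR : 0 ≤ R) (hy : ‖y‖ = R) (hyx : y ≠ x) : ‖secantMap R x y‖ = R := by
  have h : ‖y - x‖ ≠ 0 := norm_ne_zero_iff.2 (sub_ne_zero.2 hyx)
  have h1 : R ^ 2 = ‖x‖ ^ 2 + 2 * inner ℝ x (y - x) + ‖y - x‖ ^ 2 := by
    rw [← norm_add_sq_real, add_sub_cancel, hy]
  refine (sq_eq_sq₀ (norm_nonneg _) hR).1 ?_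
  rw [secantMap, norm_add_sq_real, inner_smul_right, norm_smul, mul_pow, Real.norm_eq_abs, sq_abs]
  have h2 : inner ℝ x (y - x) = (R ^ 2 - ‖x‖ ^ 2 - ‖y - x‖ ^ 2) / 2 := by linarith
  rw [h2]
  field_simp
  ring

theorem sRatio_secantMap (hy : y ≠ x) :
    sRatio R x (secantMap R x y) = (sRatio R x y)⁻¹ := by
  have h : ‖y - x‖ ≠ 0 := norm_ne_zero_iff.2 (sub_ne_zero.2 hy)
  rw [sRatio, sRatio, norm_sub_rev, norm_secantMap_sub hy, norm_sub_rev x y]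
  by_cases hs : |‖x‖ ^ 2 - R ^ 2| = 0
  · simp [hs]
  field_simp

theorem sRatio_pos (hs : ‖x‖ ^ 2 - R ^ 2 ≠ 0) (hy : y ≠ x) : 0 < sRatio R x y := by
  have h : 0 < ‖x - y‖ := norm_pos_iff.2 (sub_ne_zero.2 hy.symm)
  have := abs_pos.2 hs
  unfold sRatio
  positivity

theorem dist_secantMap_secantMap (hy : y ≠ x) (hz : z ≠ x) :
    dist (secantMap R x y) (secantMap R x z) =
      |‖x‖ ^ 2 - R ^ 2| / (‖y - x‖ * ‖z - x‖) * dist y z := by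
  have h := dist_div_norm_sq_smul (sub_ne_zero.2 hy) (sub_ne_zero.2 hz) 1
  have e : ∀ w, secantMap R x w = x + (‖x‖ ^ 2 - R ^ 2) • ((1 / ‖w - x‖) ^ 2 • (w - x)) := by
    intro w
    rw [secantMap, smul_smul]
    congr 2
    ring
  rw [e, e, dist_add_left, dist_smul₀, h, dist_sub_right, Real.norm_eq_abs]
  ring

theorem lipschitzOnWith_secantMap (a : ℝ≥0) :
    LipschitzOnWith a (secantMap R x) ({x}ᶜ ∩ {y | (sRatio R x y).toNNReal ≤ a}) := by
  refine LipschitzOnWith.of_dist_le_mul fun y hy z hz => ?_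
  rw [dist_secantMap_secantMap hy.1 hz.1]
  gcongr
  have hy0 : 0 < ‖y - x‖ := norm_pos_iff.2 (sub_ne_zero.2 hy.1)
  have hz0 : 0 < ‖z - x‖ := norm_pos_iff.2 (sub_ne_zero.2 hz.1)
  have h1 : |‖x‖ ^ 2 - R ^ 2| ≤ a * ‖y - x‖ ^ 2 := by
    rw [← div_le_iff₀ (by positivity), norm_sub_rev]
    exact Real.toNNReal_le_iff_le_coe.1 hy.2
  have h2 : |‖x‖ ^ 2 - R ^ 2| ≤ a * ‖z - x‖ ^ 2 := by
    rw [← div_le_iff₀ (by positivity), norm_sub_rev]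
    exact Real.toNNReal_le_iff_le_coe.1 hz.2
  rw [div_le_iff₀ (by positivity)]
  refine (sq_le_sq₀ (abs_nonneg _) (by positivity)).1 ?_
  calc |‖x‖ ^ 2 - R ^ 2| ^ 2 = |‖x‖ ^ 2 - R ^ 2| * |‖x‖ ^ 2 - R ^ 2| := sq _
    _ ≤ (a * ‖y - x‖ ^ 2) * (a * ‖z - x‖ ^ 2) := by gcongr
    _ = _ := by ring

theorem measurable_secantMap : Measurable (secantMap R x) := by
  unfold secantMap
  fun_prop

theorem measurable_sRatio : Measurable (sRatio R x) := by
  unfold sRatio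
  fun_prop

theorem map_secantMap_withDensity (d : ℝ) (hd : 0 ≤ d) (hR : 0 < R) (hx : ‖x‖ ≠ R) :
    (((μH[d] : Measure (EuclideanSpace ℝ (Fin n))).restrict (sphere 0 R)).withDensity
      fun y => ((sRatio R x y).toNNReal : ℝ≥0∞) ^ d).map (secantMap R x) =
      (μH[d]).restrict (sphere 0 R) := by
  set S : Set (EuclideanSpace ℝ (Fin n)) := sphere 0 R with hS
  set μ := (μH[d] : Measure (EuclideanSpace ℝ (Fin n))).restrict S with hμ
  set W : EuclideanSpace ℝ (Fin n) → ℝ≥0 := fun y => (sRatio R x y).toNNReal with hWdef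
  set T := secantMap R x with hT
  have hs : ‖x‖ ^ 2 - R ^ 2 ≠ 0 := by
    rw [sub_ne_zero]
    exact fun h => hx ((sq_eq_sq₀ (norm_nonneg _) hR.le).1 h)
  have hSm : MeasurableSet S := isClosed_sphere.measurableSet
  have hSx : ∀ y ∈ S, y ≠ x := by
    rintro y hy rfl
    exact hx (by simpa [hS] using hy)
  have hTS : ∀ y ∈ S, T y ∈ S := by
    intro y hy
    have := norm_secantMap hR.le (by simpa [hS] using hy) (hSx y hy)
    simpa [hS] using this
  have hTT : ∀ y, T (T y) = y := fun y => secantMap_secantMap hs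
  have hTm : Measurable T := measurable_secantMap
  have hWm : Measurable W := measurable_sRatio.real_toNNReal
  have hWm' : Measurable fun y => (W y : ℝ≥0∞) ^ d := hWm.coe_nnreal_ennreal.pow_const d
  have hWT : ∀ y ∈ S, (W (T y) : ℝ≥0∞) ^ d * (W y : ℝ≥0∞) ^ d = 1 := by
    intro y hy
    have h0 : W y ≠ 0 := (Real.toNNReal_pos.2 (sRatio_pos hs (hSx y hy))).ne'
    have h1 : W (T y) = (W y)⁻¹ := by
      simp only [hWdef, hT, sRatio_secantMap (hSx y hy), Real.toNNReal_inv]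
    rw [← ENNReal.mul_rpow_of_nonneg _ _ hd, h1, ← ENNReal.coe_mul, inv_mul_cancel₀ h0]
    simp
  have hle : μ ≤ (μ.withDensity fun y => (W y : ℝ≥0∞) ^ d).map T := by
    refine Measure.le_iff.2 fun B hB => ?_
    rw [Measure.map_apply hTm hB, withDensity_apply _ (hTm hB), hμ, Measure.restrict_apply hB,
      Measure.restrict_restrict (hTm hB)]
    have himg : B ∩ S = T '' (T ⁻¹' B ∩ S) := by
      ext z
      constructor
      · rintro ⟨hz, hzS⟩
        exact ⟨T z, ⟨by simpa [hTT] using hz, hTS z hzS⟩, hTT z⟩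
      · rintro ⟨y, ⟨hy, hyS⟩, rfl⟩
        exact ⟨hy, hTS y hyS⟩
    rw [himg]
    refine hausdorffMeasure_image_le_lintegral_rpow hd ((hTm hB).inter hSm) hWm
      (fun y hy => (Real.toNNReal_pos.2 (sRatio_pos hs (hSx y hy.2))).ne') fun a => ?_
    exact (lipschitzOnWith_secantMap a).mono fun y hy => ⟨hSx y hy.1.2, hy.2⟩
  have hlint : ∀ g : EuclideanSpace ℝ (Fin n) → ℝ≥0∞, Measurable g →
      ∫⁻ y, g y ∂((μ.withDensity fun y => (W y : ℝ≥0∞) ^ d).map T) =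
        ∫⁻ y, (W y : ℝ≥0∞) ^ d * g (T y) ∂μ := by
    intro g hg
    rw [lintegral_map hg hTm]
    exact lintegral_withDensity_eq_lintegral_mul _ hWm' (hg.comp hTm)
  refine le_antisymm (Measure.le_iff.2 fun B hB => ?_) hle
  have hg : Measurable (B.indicator (1 : EuclideanSpace ℝ (Fin n) → ℝ≥0∞)) :=
    measurable_one.indicator hB
  rw [← lintegral_indicator_one hB, ← lintegral_indicator_one hB, hlint _ hg]
  refine (lintegral_mono' hle le_rfl).trans_eq ?_
  refine (hlint _ (hWm'.mul (hg.comp hTm))).trans ?_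
  refine setLIntegral_congr_fun hSm fun y hy => ?_
  simp only [Pi.mul_apply, Function.comp_apply, hTT]
  rw [← mul_assoc, mul_comm ((W y : ℝ≥0∞) ^ d), hWT y hy, one_mul]

theorem setIntegral_sphere_comp_secantMap (d : ℝ) (hd : 0 ≤ d) (hR : 0 < R) (hx : ‖x‖ ≠ R)
    {f : EuclideanSpace ℝ (Fin n) → ℝ} (hf : Measurable f) :
    ∫ y in sphere 0 R, sRatio R x y ^ d * f (secantMap R x y) ∂(μH[d]) =
      ∫ y in sphere 0 R, f y ∂(μH[d]) := by
  conv_rhs => rw [← map_secantMap_withDensity d hd hR hx]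
  rw [integral_map measurable_secantMap.aemeasurable hf.aestronglyMeasurable,
    integral_withDensity_eq_integral_toReal_smul
      (measurable_sRatio.real_toNNReal.coe_nnreal_ennreal.pow_const d)
      (ae_of_all _ fun y => ENNReal.rpow_lt_top_of_nonneg hd ENNReal.coe_ne_top)]
  refine integral_congr_ae (ae_of_all _ fun y => ?_)
  have : 0 ≤ sRatio R x y := by unfold sRatio; positivity
  simp [← ENNReal.toReal_rpow, Real.coe_toNNReal _ this]

end secantMap

theorem setIntegral_sphere_rpow_mul_sin_log_eq_zero {n : ℕ} {R : ℝ}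
    {x : EuclideanSpace ℝ (Fin n)} {d : ℝ} (hd : 0 ≤ d) (hR : 0 < R) (hx : ‖x‖ ≠ R) (b : ℝ) :
    ∫ y in sphere (0 : EuclideanSpace ℝ (Fin n)) R,
      sRatio R x y ^ (d / 2) * Real.sin (b * Real.log (sRatio R x y)) ∂(μH[d]) = 0 := by
  have hs : ‖x‖ ^ 2 - R ^ 2 ≠ 0 := by
    rw [sub_ne_zero]
    exact fun h => hx ((sq_eq_sq₀ (norm_nonneg _) hR.le).1 h)
  have hm : Measurable fun y : EuclideanSpace ℝ (Fin n) =>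
      sRatio R x y ^ (d / 2) * Real.sin (b * Real.log (sRatio R x y)) :=
    (measurable_sRatio.pow_const _).mul
      (Real.measurable_sin.comp ((Real.measurable_log.comp measurable_sRatio).const_mul b))
  have h := setIntegral_sphere_comp_secantMap d hd hR hx hm
  rw [setIntegral_congr_fun (g := fun y => -(sRatio R x y ^ (d / 2) *
    Real.sin (b * Real.log (sRatio R x y)))) isClosed_sphere.measurableSet, integral_neg] at h
  · linarith
  intro y hy
  have hyx : y ≠ x := by
    rintro rfl
    exact hx (by simpa using hy)
  have hp := sRatio_pos hs hyx
  have e : sRatio R x y ^ d = sRatio R x y ^ (d / 2) * sRatio R x y ^ (d / 2) := by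
    rw [← Real.rpow_add hp, add_halves]
  have hne : sRatio R x y ^ (d / 2) ≠ 0 := (Real.rpow_pos_of_pos hp _).ne'
  simp only [sRatio_secantMap hyx, Real.log_inv, mul_neg, Real.sin_neg, Real.inv_rpow hp.le, e]
  field_simp

theorem stmt_4 (k : ℕ) (hk : 1 ≤ k) (R : ℝ) (hR : 0 < R)
    (x : EuclideanSpace ℝ (Fin (k + 1))) (hx : ‖x‖ ≠ R) (b : ℝ) :
    ∫ y in Metric.sphere (0 : EuclideanSpace ℝ (Fin (k + 1))) R,
        Complex.exp (((k : ℂ) / 2 + Complex.I * (b : ℂ)) *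
          (Real.log (sRatio R x y) : ℂ)) ∂(μH[(k : ℝ)]) =
    ((∫ y in Metric.sphere (0 : EuclideanSpace ℝ (Fin (k + 1))) R,
        (sRatio R x y) ^ ((k : ℝ) / 2) *
          Real.cos (b * Real.log (sRatio R x y)) ∂(μH[(k : ℝ)]) : ℝ) : ℂ) := by
  have hs : ‖x‖ ^ 2 - R ^ 2 ≠ 0 := by
    rw [sub_ne_zero]
    exact fun h => hx ((sq_eq_sq₀ (norm_nonneg _) hR.le).1 h)
  have hyx : ∀ y ∈ sphere (0 : EuclideanSpace ℝ (Fin (k + 1))) R, y ≠ x := by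
    rintro y hy rfl
    exact hx (by simpa using hy)
  have hSm : MeasurableSet (sphere (0 : EuclideanSpace ℝ (Fin (k + 1))) R) :=
    isClosed_sphere.measurableSet
  have hexp : ∀ y, ((k : ℂ) / 2 + Complex.I * (b : ℂ)) * (Real.log (sRatio R x y) : ℂ) =
      ((k / 2 * Real.log (sRatio R x y) : ℝ) : ℂ) +
        ((b * Real.log (sRatio R x y) : ℝ) : ℂ) * Complex.I := by
    intro y
    push_cast
    ring
  have hcont : ContinuousOn (fun y => Complex.exp (((k : ℂ) / 2 + Complex.I * (b : ℂ)) *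
      (Real.log (sRatio R x y) : ℂ))) (sphere 0 R) := by
    have h1 : ContinuousOn (sRatio R x) (sphere 0 R) := by
      unfold sRatio
      refine continuousOn_const.div (by fun_prop) fun y hy => ?_
      exact pow_ne_zero _ (norm_ne_zero_iff.2 (sub_ne_zero.2 (hyx y hy).symm))
    have h2 : ContinuousOn (fun y => Real.log (sRatio R x y)) (sphere 0 R) :=
      h1.log fun y hy => (sRatio_pos hs (hyx y hy)).ne'
    fun_prop
  have hint : IntegrableOn (fun y => Complex.exp (((k : ℂ) / 2 + Complex.I * (b : ℂ)) *
      (Real.log (sRatio R x y) : ℂ))) (sphere 0 R) (μH[(k : ℝ)]) := by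
    obtain ⟨C, hC⟩ := (isCompact_sphere _ _).exists_bound_of_continuousOn hcont
    exact IntegrableOn.of_bound (hausdorffMeasure_sphere_lt_top k hR)
      (hcont.aestronglyMeasurable hSm) C ((ae_restrict_iff' hSm).2 (ae_of_all _ hC))
  rw [← setIntegral_re_add_im hint]
  have hre : ∀ y ∈ sphere (0 : EuclideanSpace ℝ (Fin (k + 1))) R,
      Real.exp (k / 2 * Real.log (sRatio R x y)) = sRatio R x y ^ ((k : ℝ) / 2) := by
    intro y hy
    rw [Real.rpow_def_of_pos (sRatio_pos hs (hyx y hy)), mul_comm]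
  have hcos : EqOn (fun y => RCLike.re (Complex.exp (((k : ℂ) / 2 + Complex.I * (b : ℂ)) *
      (Real.log (sRatio R x y) : ℂ)))) (fun y => sRatio R x y ^ ((k : ℝ) / 2) *
      Real.cos (b * Real.log (sRatio R x y))) (sphere 0 R) := by
    intro y hy
    simp only [hexp, ← hre y hy, RCLike.re_to_complex, Complex.exp_re, Complex.add_im, Complex.add_re, Complex.ofReal_re,
      Complex.ofReal_im, Complex.re_ofReal_mul, Complex.im_ofReal_mul, Complex.I_re, Complex.I_im,
      mul_zero, add_zero, mul_one, zero_add]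
  have hsin : EqOn (fun y => RCLike.im (Complex.exp (((k : ℂ) / 2 + Complex.I * (b : ℂ)) *
      (Real.log (sRatio R x y) : ℂ)))) (fun y => sRatio R x y ^ ((k : ℝ) / 2) *
      Real.sin (b * Real.log (sRatio R x y))) (sphere 0 R) := by
    intro y hy
    simp only [hexp, ← hre y hy, RCLike.im_to_complex, Complex.exp_im, Complex.add_im, Complex.add_re, Complex.ofReal_re,
      Complex.ofReal_im, Complex.re_ofReal_mul, Complex.im_ofReal_mul, Complex.I_re, Complex.I_im,
      mul_zero, add_zero, mul_one, zero_add]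
  rw [setIntegral_congr_fun hSm hcos, setIntegral_congr_fun hSm hsin,
    setIntegral_sphere_rpow_mul_sin_log_eq_zero (Nat.cast_nonneg k) hR hx b]
  simp
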